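/- For all integers n ≥ 0, the number a_{11}(11n + 1) is divisible by 11. -/

import Mathlib

/-- `a k n` is the number of partitions of `n` in which each odd part may appear in any
of `k` colors and even parts appear in at most one color: equivalently, the number of
`k`-tuples `(λ_0, …, λ_{k-1})` of partitions where `λ_0` is an ordinary partition,
`λ_1, …, λ_{k-1}` are partitions into odd parts, and the sums of their parts add up to `n`.
Each partition is recorded as a multiset of positive parts. -/
noncomputable def coloredPartition (k n : ℕ) : ℕ :=
  Set.ncard {c : Fin k → Multiset ℕ |
    (∀ i, ∀ x ∈ c i, 0 < x) ∧
    (∀ i : Fin k, i.val ≠ 0 → ∀ x ∈ c i, Odd x) ∧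
    (∑ i, (c i).sum) = n}

namespace CP11

open PowerSeries Finset

noncomputable section

instance fact11 : Fact (Nat.Prime 11) := ⟨by norm_num⟩

abbrev F := ZMod 11

/-- Euler's function `∏ (1 - q^i)` modulo 11. -/
def eul : F⟦X⟧ := pentagonalSeries F

/-- Finite `q`-Pochhammer symbol. -/
def poch (n : ℕ) : F⟦X⟧ := ∏ i ∈ range n, (1 - X ^ (i + 1))

/-- Gaussian binomial. -/
def gau : ℕ → ℕ → F⟦X⟧
  | _, 0 => 1
  | 0, _ + 1 => 0
  | N + 1, k + 1 => gau N k + X ^ (k + 1) * gau N (k + 1)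

lemma gau_zero (N : ℕ) : gau N 0 = 1 := by cases N <;> simp [gau]

lemma gau_succ (N k : ℕ) : gau (N + 1) (k + 1) = gau N k + X ^ (k + 1) * gau N (k + 1) := by
  simp [gau]

lemma gau_lt (N k : ℕ) (h : N < k) : gau N k = 0 := by
  induction N generalizing k with
  | zero => obtain ⟨k, rfl⟩ : ∃ j, k = j + 1 := ⟨k - 1, by omega⟩; simp [gau]
  | succ N ih =>
    obtain ⟨k, rfl⟩ : ∃ j, k = j + 1 := ⟨k - 1, by omega⟩
    rw [gau_succ, ih k (by omega), ih (k + 1) (by omega)]; simp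

lemma poch_succ (n : ℕ) : poch (n + 1) = poch n * (1 - X ^ (n + 1)) := by
  simp [poch, prod_range_succ]

lemma gau_mul (N k l : ℕ) (h : N = k + l) : gau N k * poch k * poch l = poch N := by
  induction N generalizing k l with
  | zero =>
    obtain ⟨rfl, rfl⟩ : k = 0 ∧ l = 0 := by omega
    simp [gau, poch]
  | succ N ih =>
    rcases k with _ | k
    · obtain rfl : l = N + 1 := by omega
      simp [gau, poch]
    · rw [gau_succ]
      have h1 := ih k l (by omega)
      rcases l with _ | l
      · obtain rfl : N = k := by omega
        rw [gau_lt N (N + 1) (by omega), poch_succ]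
        linear_combination (1 - X ^ (N + 1)) * h1
      · have h2 := ih (k + 1) l (by omega)
        obtain rfl : N = k + l + 1 := by omega
        rw [poch_succ (k + l + 1)]
        rw [poch_succ] at h1 h2 ⊢
        rw [poch_succ l]
        linear_combination (1 - X ^ (k + 1)) * h1 + X ^ (k + 1) * (1 - X ^ (l + 1)) * h2

lemma qbinom {A : Type*} [CommRing A] (φ : F⟦X⟧ →+* A) (N : ℕ) (x y : A) :
    ∏ i ∈ range N, (y + x * φ X ^ i) =
      ∑ k ∈ range (N + 1), φ X ^ (k.choose 2) * φ (gau N k) * x ^ k * y ^ (N - k) := by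
  induction N generalizing x with
  | zero => simp [gau]
  | succ N ih =>
    rw [prod_range_succ']
    have h := ih (x * φ X)
    have e : ∏ i ∈ range N, (y + x * φ X ^ (i + 1)) =
        ∏ i ∈ range N, (y + x * φ X * φ X ^ i) := by
      refine prod_congr rfl fun i _ => ?_
      ring
    rw [e, h, sum_range_succ' _ (N + 1)]
    have e2 : ∀ k ∈ range (N + 1),
        φ X ^ ((k + 1).choose 2) * φ (gau (N + 1) (k + 1)) * x ^ (k + 1) *
          y ^ (N + 1 - (k + 1)) =
        x * (φ X ^ (k.choose 2) * φ (gau N k) * (x * φ X) ^ k * y ^ (N - k)) +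
        φ X ^ ((k + 1).choose 2) * φ (gau N (k + 1)) * (x * φ X) ^ (k + 1) * y ^ (N - k) := by
      intro k _
      rw [gau_succ, Nat.add_sub_add_right, Nat.choose_succ_succ' k 1, Nat.choose_one_right]
      simp only [map_mul, map_add, map_pow]
      ring
    rw [sum_congr rfl e2, sum_add_distrib, ← mul_sum]
    have e3 : ∑ k ∈ range (N + 1), φ X ^ ((k + 1).choose 2) * φ (gau N (k + 1)) *
          (x * φ X) ^ (k + 1) * y ^ (N - k) + y ^ (N + 1) =
        y * ∑ k ∈ range (N + 1), φ X ^ (k.choose 2) * φ (gau N k) *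
          (x * φ X) ^ k * y ^ (N - k) := by
      rw [sum_range_succ, gau_lt N (N + 1) (by omega), sum_range_succ' _ N, mul_add, mul_sum]
      simp only [mul_zero, map_zero, zero_mul, add_zero]
      congr 1
      · refine sum_congr rfl fun k hk => ?_
        have : N - k = (N - (k + 1)) + 1 := by have := mem_range.1 hk; omega
        rw [this]; ring
      · simp [gau_zero]; ring
    simp only [gau_zero, Nat.choose_zero_succ, pow_zero, mul_one, map_one, Nat.sub_zero, one_mul]
    linear_combination -e3

lemma jac_zero (n : ℕ) :
    ∑ k ∈ range (2 * n + 2), (-1 : F⟦X⟧) ^ k * X ^ (k.choose 2 + n * (2 * n + 1 - k)) *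
      gau (2 * n + 1) k = 0 := by
  have h := qbinom (RingHom.id F⟦X⟧) (2 * n + 1) (-1) (X ^ n)
  rw [prod_eq_zero (i := n) (by simp; omega) (by simp)] at h
  rw [h]
  refine sum_congr rfl fun k _ => ?_
  simp only [RingHom.id_apply, pow_add, pow_mul]
  ring

lemma prod_half (n : ℕ) :
    ∏ i ∈ range n, ((X : F⟦X⟧) ^ n - X ^ i) = (-1) ^ n * X ^ (n.choose 2) * poch n := by
  have e : ∀ i ∈ range n, ((X : F⟦X⟧) ^ n - X ^ i) = (-1) * X ^ i * (1 - X ^ (n - 1 - i + 1)) := by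
    intro i hi
    have : n = i + (n - 1 - i + 1) := by have := mem_range.1 hi; omega
    conv_lhs => rw [this]
    ring
  rw [prod_congr rfl e, prod_mul_distrib, prod_mul_distrib, prod_const, card_range,
    prod_pow_eq_pow_sum, sum_range_id, poch, prod_range_reflect (fun i => (1 - (X : F⟦X⟧) ^ (i + 1))),
    Nat.choose_two_right]

lemma prod_half' (n : ℕ) :
    ∏ i ∈ range n, ((X : F⟦X⟧) ^ n - X ^ (n + 1 + i)) = X ^ (n * n) * poch n := by
  have e : ∀ i ∈ range n, ((X : F⟦X⟧) ^ n - X ^ (n + 1 + i)) = X ^ n * (1 - X ^ (i + 1)) := by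
    intro i hi
    ring
  rw [prod_congr rfl e, prod_mul_distrib, prod_const, card_range, poch, pow_mul]

lemma hpgen {B : Type*} [CommRing B] (z q : B) (n : ℕ) :
    ∏ i ∈ range (2 * n + 1), (q ^ n + -z * q ^ i) =
    (1 - z) * (q ^ n * ((∏ i ∈ range n, (q ^ n - z * q ^ i)) *
      ∏ i ∈ range n, (q ^ n - z * q ^ (n + 1 + i)))) := by
  rw [show 2 * n + 1 = (n + 1) + n by omega, prod_range_add, prod_range_succ]
  simp only [neg_mul, ← sub_eq_add_neg]
  ring

lemma termgen {B : Type*} [CommRing B] (z q g : B) (c n k l : ℕ) :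
    q ^ c * g * (-z) ^ k * (q ^ n) ^ l = (q ^ (c + n * l) * g * (-1) ^ k) * z ^ k := by
  rw [neg_pow, pow_add, pow_mul]
  ring

lemma jac_deriv (n : ℕ) :
    ∑ k ∈ range (2 * n + 2), (-1 : F⟦X⟧) ^ k * (k : F⟦X⟧) *
      X ^ (k.choose 2 + n * (2 * n + 1 - k)) * gau (2 * n + 1) k =
    - (-1) ^ n * X ^ (n + n.choose 2 + n * n) * (poch n * poch n) := by
  have h := qbinom (Polynomial.C : F⟦X⟧ →+* _) (2 * n + 1) (-Polynomial.X) (Polynomial.C X ^ n)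
  rw [hpgen] at h
  simp only [termgen] at h
  have h2 := congrArg (fun p => Polynomial.eval 1 (Polynomial.derivative p)) h
  have hc : ∀ k, (Polynomial.C (X : F⟦X⟧) ^ (k.choose 2 + n * (2 * n + 1 - k)) *
      Polynomial.C (gau (2 * n + 1) k) * (-1) ^ k) =
      Polynomial.C (X ^ (k.choose 2 + n * (2 * n + 1 - k)) * gau (2 * n + 1) k * (-1) ^ k) := by
    intro k
    rw [Polynomial.C_mul, Polynomial.C_mul, Polynomial.C_pow, Polynomial.C_pow, Polynomial.C_neg,
      Polynomial.C_1]
  simp only [hc] at h2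
  simp only [Polynomial.derivative_mul, Polynomial.eval_add, Polynomial.eval_mul,
    Polynomial.eval_sub, Polynomial.eval_one, Polynomial.eval_X, sub_self, zero_mul,
    add_zero, Polynomial.derivative_sub, Polynomial.derivative_one, Polynomial.derivative_X,
    zero_sub, Polynomial.eval_prod, Polynomial.eval_pow,
    Polynomial.eval_C, one_mul, prod_half, prod_half', Polynomial.derivative_sum,
    Polynomial.eval_finsetSum, Polynomial.derivative_C, Polynomial.derivative_X_pow,
    Polynomial.eval_neg, one_pow, mul_one, zero_add, Polynomial.eval_natCast, map_natCast] at h2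
  rw [show - (-1) ^ n * X ^ (n + n.choose 2 + n * n) * (poch n * poch n) =
    -1 * (X ^ n * ((-1) ^ n * X ^ n.choose 2 * poch n *
      (X ^ (n * n) * poch n))) by ring]
  rw [h2]
  refine sum_congr rfl fun k _ => ?_
  ring

lemma poch_dvd (k : ℕ) : (X : F⟦X⟧) ^ (k + 1) ∣ eul - poch k := by
  rw [X_pow_dvd_iff]
  intro m hm
  have h1 := coeff_prod_one_sub_X_pow_eventually_eq F m
  obtain ⟨s, hs, hsk⟩ := (h1.and (Filter.eventually_ge_atTop (range k))).exists
  rw [map_sub, eul, ← hs, ← map_sub]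
  have h2 : (X : F⟦X⟧) ^ (k + 1) ∣ ∏ i ∈ s \ range k, (1 - X ^ (i + 1)) - 1 := by
    refine prod_induction _ (fun p : F⟦X⟧ => X ^ (k + 1) ∣ p - 1) ?_ (by simp) ?_
    · intro a b ha hb
      have : a * b - 1 = (a - 1) * b + (b - 1) := by ring
      rw [this]
      exact dvd_add (ha.mul_right _) hb
    · intro i hi
      have : k ≤ i := by simpa using (mem_sdiff.1 hi).2
      rw [sub_sub_cancel_left]
      exact (pow_dvd_pow _ (by omega)).neg_right
  have h3 : ∏ i ∈ s, (1 - (X : F⟦X⟧) ^ (i + 1)) - poch k =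
      (∏ i ∈ s \ range k, (1 - X ^ (i + 1)) - 1) * poch k := by
    rw [← prod_sdiff hsk, poch]; ring
  rw [h3]
  exact X_pow_dvd_iff.1 (h2.mul_right _) m hm

lemma eul_unit : IsUnit eul := by
  rw [PowerSeries.isUnit_iff_constantCoeff]
  have h := X_pow_dvd_iff.1 (poch_dvd 0) 0 (by simp)
  simp [poch, sub_eq_zero] at h
  simp [h]

lemma gau_dvd (N k l s : ℕ) (h : N = k + l) (hk : s ≤ k) (hl : s ≤ l) :
    (X : F⟦X⟧) ^ (s + 1) ∣ gau N k * eul - 1 := by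
  have h0 := gau_mul N k l h
  have a1 : (X : F⟦X⟧) ^ (s + 1) ∣ _ := (pow_dvd_pow _ (by omega)).trans (poch_dvd k)
  have a2 : (X : F⟦X⟧) ^ (s + 1) ∣ _ := (pow_dvd_pow _ (by omega)).trans (poch_dvd l)
  have a3 : (X : F⟦X⟧) ^ (s + 1) ∣ _ := (pow_dvd_pow _ (by omega)).trans (poch_dvd N)
  have : (X : F⟦X⟧) ^ (s + 1) ∣ eul * (gau N k * eul - 1) := by
    have : eul * (gau N k * eul - 1) = gau N k * eul * (eul - poch k) +
      gau N k * poch k * (eul - poch l) - (eul - poch N) := by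
      linear_combination h0
    rw [this]
    exact dvd_sub (dvd_add (a1.mul_left _) (a2.mul_left _)) a3
  exact (eul_unit.dvd_mul_left).1 this

/-- The exponent identity in Jacobi's sum. -/
lemma expo (n k : ℕ) (hk : k ≤ 2 * n + 1) :
    (2 * (k.choose 2 + n * (2 * n + 1 - k) : ℕ) : ℤ) =
      2 * (n + n.choose 2 + n * n : ℕ) + ((k : ℤ) - n) * (k - n - 1) := by
  have e : ∀ j : ℕ, (2 * (j.choose 2 : ℕ) : ℤ) = j * (j - 1) := by
    intro j
    have := Nat.triangle_succ (j - 1)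
    rcases j with _ | j
    · simp
    · have h := Nat.choose_two_right (j + 1)
      have h2 : 2 ∣ (j + 1) * (j + 1 - 1) := by
        simpa [mul_comm] using (Nat.even_mul_succ_self j).two_dvd
      have : 2 * (j + 1).choose 2 = (j + 1) * (j + 1 - 1) := by omega
      zify at this
      push_cast at this ⊢
      simpa using this
  push_cast [Nat.cast_sub hk]
  linear_combination e k - e n

lemma int_mul_pred_nonneg (d : ℤ) : 0 ≤ d * (d - 1) := by
  rcases le_or_gt d 0 with h | h
  · nlinarith
  · exact mul_nonneg h.le (by omega)

lemma sq_check (m : ℕ) (hm : m % 11 ∈ ({2, 4, 5, 7, 8, 9} : Finset ℕ)) (s : F)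
    (h : 8 * (m : F) + 1 = s ^ 2) : s = 0 := by
  have h2 : (m : F) = ((m % 11 : ℕ) : F) := by simp
  rw [h2] at h
  generalize m % 11 = r at *
  simp only [mem_insert, mem_singleton] at hm
  clear h2
  revert s
  rcases hm with rfl | rfl | rfl | rfl | rfl | rfl <;> decide

lemma jacobi (m : ℕ) (hm : m % 11 ∈ ({2, 4, 5, 7, 8, 9} : Finset ℕ)) :
    coeff m (eul ^ 3) = 0 := by
  have he := expo m
  have h0 := jac_zero m
  have h1 := jac_deriv m
  set E := m + m.choose 2 + m * m with hE
  obtain ⟨e, hedef⟩ : ∃ e : ℕ → ℕ, ∀ k, k.choose 2 + m * (2 * m + 1 - k) = e k := ⟨_, fun _ => rfl⟩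
  simp only [hedef] at he h0 h1
  obtain ⟨w, hw⟩ : ∃ w : ℕ → F, ∀ k, w k = (-1) ^ k * (2 * (k : F) - 2 * (m : F) - 1) :=
    ⟨_, fun _ => rfl⟩
  -- the weighted identity
  have h2 : ∑ k ∈ range (2 * m + 2), C (w k) * X ^ (e k) * gau (2 * m + 1) k =
      - 2 * (-1) ^ m * X ^ E * (poch m * poch m) := by
    have : ∀ k ∈ range (2 * m + 2), C (w k) * X ^ (e k) * gau (2 * m + 1) k =
      2 * ((-1 : F⟦X⟧) ^ k * (k : F⟦X⟧) * PowerSeries.X ^ (e k) *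
      gau (2 * m + 1) k) - (2 * (m : F⟦X⟧) + 1) * ((-1 : F⟦X⟧) ^ k *
      X ^ (e k) * gau (2 * m + 1) k) := by
      intro k _
      rw [hw]
      simp only [map_mul, map_pow, map_neg, map_one, map_sub, map_natCast, map_ofNat]
      ring
    rw [sum_congr rfl this, sum_sub_distrib, ← mul_sum, ← mul_sum, h0, h1]
    ring
  have h3 : (X : F⟦X⟧) ^ (E + m + 1) ∣
      (∑ k ∈ range (2 * m + 2), C (w k) * X ^ (e k) * gau (2 * m + 1) k) * eul -
      ∑ k ∈ range (2 * m + 2), C (w k) * X ^ (e k) := by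
    rw [sum_mul, ← sum_sub_distrib]
    refine dvd_sum fun k hk => ?_
    have hk' : k ≤ 2 * m + 1 := by have := mem_range.1 hk; omega
    have e1 : ∀ b c d : F⟦X⟧, b * c * d * eul - b * c = b * (c * (d * eul - 1)) := by
      intros; ring
    rw [e1]
    refine Dvd.dvd.mul_left ?_ _
    have he := he k hk'
    rcases le_or_gt k m with hkm | hkm
    · have := gau_dvd (2 * m + 1) k (2 * m + 1 - k) k (by omega) le_rfl (by omega)
      refine (pow_dvd_pow _ ?_).trans ((pow_add _ _ _).dvd.trans (mul_dvd_mul_left _ this))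
      zify
      have := int_mul_pred_nonneg (m - k)
      nlinarith
    · have := gau_dvd (2 * m + 1) k (2 * m + 1 - k) (2 * m + 1 - k) (by omega) (by omega) le_rfl
      refine (pow_dvd_pow _ ?_).trans ((pow_add _ _ _).dvd.trans (mul_dvd_mul_left _ this))
      zify [hk']
      have := int_mul_pred_nonneg (k - m - 1)
      nlinarith
  rw [h2] at h3
  have h4 : (X : F⟦X⟧) ^ (E + m + 1) ∣ X ^ E * ((-2) * (-1) ^ m * eul ^ 3) -
      (- 2 * (-1) ^ m * X ^ E * (poch m * poch m)) * eul := by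
    have := poch_dvd m
    rw [show X ^ E * ((-2) * (-1) ^ m * eul ^ 3) -
      (- 2 * (-1) ^ m * X ^ E * (poch m * poch m)) * eul =
      X ^ E * (eul - poch m) * ((-2) * (-1) ^ m * eul * (eul + poch m)) by ring, add_assoc, pow_add]
    exact (mul_dvd_mul_left _ this).mul_right _
  have h5 := dvd_add h4 h3
  rw [sub_add_sub_cancel] at h5
  have h6 := X_pow_dvd_iff.1 h5 (m + E) (by omega)
  have h7 : coeff (m + E) (∑ k ∈ range (2 * m + 2), C (w k) * (X : F⟦X⟧) ^ (e k)) = 0 := by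
    rw [map_sum]
    refine sum_eq_zero fun k hk => ?_
    rw [coeff_C_mul, coeff_X_pow]
    split_ifs with h
    · rw [mul_one, hw, sq_check m hm (2 * (k : F) - 2 * (m : F) - 1), mul_zero]
      have := he k (by have := mem_range.1 hk; omega)
      rw [← h] at this
      push_cast at this
      have h8 : (8 * (m : ℤ) + 1) = (2 * (k : ℤ) - 2 * m - 1) ^ 2 := by linarith
      have := congrArg (Int.cast : ℤ → F) h8
      push_cast at this
      exact this
    · simp
  rw [map_sub, h7, sub_zero, coeff_X_pow_mul] at h6
  have h8 : (-2 * (-1) ^ m * eul ^ 3 : F⟦X⟧) = C (-2 * (-1) ^ m : F) * eul ^ 3 := by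
    simp only [map_mul, map_pow, map_neg, map_one, map_ofNat]
  rw [h8, coeff_C_mul] at h6
  refine (mul_eq_zero.1 h6).resolve_left ?_
  refine mul_ne_zero (by decide) (pow_ne_zero _ (by decide))

set_option linter.unusedSimpArgs false
lemma alg {A : Type*} [CommRing A] (h11 : (11 : A) = 0) (j1 j2 j3 j4 : ℕ → A)
    (z2 : j1 2 = 0) (z4 : j1 4 = 0) (z5 : j1 5 = 0) (z7 : j1 7 = 0) (z8 : j1 8 = 0) (z9 : j1 9 = 0)
    (h2 : ∀ r < 11, j2 r = ∑ s ∈ range 11, j1 s * j1 ((r + 11 - s) % 11))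
    (h3 : ∀ r < 11, j3 r = ∑ s ∈ range 11, j2 s * j1 ((r + 11 - s) % 11))
    (h4 : ∀ r < 11, j4 r = ∑ s ∈ range 11, j2 s * j2 ((r + 11 - s) % 11))
    (y3 : j4 3 = 0) (y6 : j4 6 = 0) (y8 : j4 8 = 0) (y9 : j4 9 = 0) (y10 : j4 10 = 0) :
    ∑ s ∈ range 11, j3 s * j4 ((6 + 11 - s) % 11) = 0 := by
  generalize ha : j1 0 = a at *
  generalize hb : j1 1 = b at *
  generalize hc : j1 3 = c at *
  generalize hd : j1 6 = d at *
  generalize he : j1 10 = e at *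
  have e2_0 : j2 0 = (2)*b*e + (1)*a^2 := by
    rw [h2 0 (by norm_num)]
    simp only [sum_range_succ, range_zero, sum_empty, Nat.reduceAdd, Nat.reduceSub, Nat.reduceMod, Nat.sub_zero, zero_add,
      ha, hb, hc, hd, he, z2, z4, z5, z7, z8, z9]
    ring
  have e2_1 : j2 1 = (1)*d^2 + (2)*a*b := by
    rw [h2 1 (by norm_num)]
    simp only [sum_range_succ, range_zero, sum_empty, Nat.reduceAdd, Nat.reduceSub, Nat.reduceMod, Nat.sub_zero, zero_add,
      ha, hb, hc, hd, he, z2, z4, z5, z7, z8, z9]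
    ring
  have e2_2 : j2 2 = (2)*c*e + (1)*b^2 := by
    rw [h2 2 (by norm_num)]
    simp only [sum_range_succ, range_zero, sum_empty, Nat.reduceAdd, Nat.reduceSub, Nat.reduceMod, Nat.sub_zero, zero_add,
      ha, hb, hc, hd, he, z2, z4, z5, z7, z8, z9]
    ring
  have e2_3 : j2 3 = (2)*a*c := by
    rw [h2 3 (by norm_num)]
    simp only [sum_range_succ, range_zero, sum_empty, Nat.reduceAdd, Nat.reduceSub, Nat.reduceMod, Nat.sub_zero, zero_add,
      ha, hb, hc, hd, he, z2, z4, z5, z7, z8, z9]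
    ring
  have e2_4 : j2 4 = (2)*b*c := by
    rw [h2 4 (by norm_num)]
    simp only [sum_range_succ, range_zero, sum_empty, Nat.reduceAdd, Nat.reduceSub, Nat.reduceMod, Nat.sub_zero, zero_add,
      ha, hb, hc, hd, he, z2, z4, z5, z7, z8, z9]
    ring
  have e2_5 : j2 5 = (2)*d*e := by
    rw [h2 5 (by norm_num)]
    simp only [sum_range_succ, range_zero, sum_empty, Nat.reduceAdd, Nat.reduceSub, Nat.reduceMod, Nat.sub_zero, zero_add,
      ha, hb, hc, hd, he, z2, z4, z5, z7, z8, z9]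
    ring
  have e2_6 : j2 6 = (1)*c^2 + (2)*a*d := by
    rw [h2 6 (by norm_num)]
    simp only [sum_range_succ, range_zero, sum_empty, Nat.reduceAdd, Nat.reduceSub, Nat.reduceMod, Nat.sub_zero, zero_add,
      ha, hb, hc, hd, he, z2, z4, z5, z7, z8, z9]
    ring
  have e2_7 : j2 7 = (2)*b*d := by
    rw [h2 7 (by norm_num)]
    simp only [sum_range_succ, range_zero, sum_empty, Nat.reduceAdd, Nat.reduceSub, Nat.reduceMod, Nat.sub_zero, zero_add,
      ha, hb, hc, hd, he, z2, z4, z5, z7, z8, z9]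
    ring
  have e2_8 : j2 8 = 0 := by
    rw [h2 8 (by norm_num)]
    simp only [sum_range_succ, range_zero, sum_empty, Nat.reduceAdd, Nat.reduceSub, Nat.reduceMod, Nat.sub_zero, zero_add,
      ha, hb, hc, hd, he, z2, z4, z5, z7, z8, z9]
    ring
  have e2_9 : j2 9 = (1)*e^2 + (2)*c*d := by
    rw [h2 9 (by norm_num)]
    simp only [sum_range_succ, range_zero, sum_empty, Nat.reduceAdd, Nat.reduceSub, Nat.reduceMod, Nat.sub_zero, zero_add,
      ha, hb, hc, hd, he, z2, z4, z5, z7, z8, z9]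
    ring
  have e2_10 : j2 10 = (2)*a*e := by
    rw [h2 10 (by norm_num)]
    simp only [sum_range_succ, range_zero, sum_empty, Nat.reduceAdd, Nat.reduceSub, Nat.reduceMod, Nat.sub_zero, zero_add,
      ha, hb, hc, hd, he, z2, z4, z5, z7, z8, z9]
    ring
  have e3_0 : j3 0 = (3)*d^2*e + (6)*a*b*e + (1)*a^3 := by
    rw [h3 0 (by norm_num)]
    simp only [sum_range_succ, range_zero, sum_empty, Nat.reduceAdd, Nat.reduceSub, Nat.reduceMod, Nat.sub_zero, zero_add,
      ha, hb, hc, hd, he, z2, z4, z5, z7, z8, z9, e2_0, e2_1, e2_2, e2_3, e2_4, e2_5, e2_6, e2_7, e2_8, e2_9, e2_10]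
    ring
  have e3_1 : j3 1 = (3)*c*e^2 + (3)*c^2*d + (3)*b^2*e + (3)*a*d^2 + (3)*a^2*b := by
    rw [h3 1 (by norm_num)]
    simp only [sum_range_succ, range_zero, sum_empty, Nat.reduceAdd, Nat.reduceSub, Nat.reduceMod, Nat.sub_zero, zero_add,
      ha, hb, hc, hd, he, z2, z4, z5, z7, z8, z9, e2_0, e2_1, e2_2, e2_3, e2_4, e2_5, e2_6, e2_7, e2_8, e2_9, e2_10]
    ring
  have e3_2 : j3 2 = (3)*b*d^2 + (6)*a*c*e + (3)*a*b^2 := by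
    rw [h3 2 (by norm_num)]
    simp only [sum_range_succ, range_zero, sum_empty, Nat.reduceAdd, Nat.reduceSub, Nat.reduceMod, Nat.sub_zero, zero_add,
      ha, hb, hc, hd, he, z2, z4, z5, z7, z8, z9, e2_0, e2_1, e2_2, e2_3, e2_4, e2_5, e2_6, e2_7, e2_8, e2_9, e2_10]
    ring
  have e3_3 : j3 3 = (6)*b*c*e + (1)*b^3 + (3)*a^2*c := by
    rw [h3 3 (by norm_num)]
    simp only [sum_range_succ, range_zero, sum_empty, Nat.reduceAdd, Nat.reduceSub, Nat.reduceMod, Nat.sub_zero, zero_add,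
      ha, hb, hc, hd, he, z2, z4, z5, z7, z8, z9, e2_0, e2_1, e2_2, e2_3, e2_4, e2_5, e2_6, e2_7, e2_8, e2_9, e2_10]
    ring
  have e3_4 : j3 4 = (3)*d*e^2 + (3)*c*d^2 + (6)*a*b*c := by
    rw [h3 4 (by norm_num)]
    simp only [sum_range_succ, range_zero, sum_empty, Nat.reduceAdd, Nat.reduceSub, Nat.reduceMod, Nat.sub_zero, zero_add,
      ha, hb, hc, hd, he, z2, z4, z5, z7, z8, z9, e2_0, e2_1, e2_2, e2_3, e2_4, e2_5, e2_6, e2_7, e2_8, e2_9, e2_10]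
    ring
  have e3_5 : j3 5 = (3)*c^2*e + (3)*b^2*c + (6)*a*d*e := by
    rw [h3 5 (by norm_num)]
    simp only [sum_range_succ, range_zero, sum_empty, Nat.reduceAdd, Nat.reduceSub, Nat.reduceMod, Nat.sub_zero, zero_add,
      ha, hb, hc, hd, he, z2, z4, z5, z7, z8, z9, e2_0, e2_1, e2_2, e2_3, e2_4, e2_5, e2_6, e2_7, e2_8, e2_9, e2_10]
    ring
  have e3_6 : j3 6 = (6)*b*d*e + (3)*a*c^2 + (3)*a^2*d := by
    rw [h3 6 (by norm_num)]
    simp only [sum_range_succ, range_zero, sum_empty, Nat.reduceAdd, Nat.reduceSub, Nat.reduceMod, Nat.sub_zero, zero_add,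
      ha, hb, hc, hd, he, z2, z4, z5, z7, z8, z9, e2_0, e2_1, e2_2, e2_3, e2_4, e2_5, e2_6, e2_7, e2_8, e2_9, e2_10]
    ring
  have e3_7 : j3 7 = (1)*d^3 + (3)*b*c^2 + (6)*a*b*d := by
    rw [h3 7 (by norm_num)]
    simp only [sum_range_succ, range_zero, sum_empty, Nat.reduceAdd, Nat.reduceSub, Nat.reduceMod, Nat.sub_zero, zero_add,
      ha, hb, hc, hd, he, z2, z4, z5, z7, z8, z9, e2_0, e2_1, e2_2, e2_3, e2_4, e2_5, e2_6, e2_7, e2_8, e2_9, e2_10]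
    ring
  have e3_8 : j3 8 = (1)*e^3 + (6)*c*d*e + (3)*b^2*d := by
    rw [h3 8 (by norm_num)]
    simp only [sum_range_succ, range_zero, sum_empty, Nat.reduceAdd, Nat.reduceSub, Nat.reduceMod, Nat.sub_zero, zero_add,
      ha, hb, hc, hd, he, z2, z4, z5, z7, z8, z9, e2_0, e2_1, e2_2, e2_3, e2_4, e2_5, e2_6, e2_7, e2_8, e2_9, e2_10]
    ring
  have e3_9 : j3 9 = (1)*c^3 + (3)*a*e^2 + (6)*a*c*d := by
    rw [h3 9 (by norm_num)]
    simp only [sum_range_succ, range_zero, sum_empty, Nat.reduceAdd, Nat.reduceSub, Nat.reduceMod, Nat.sub_zero, zero_add,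
      ha, hb, hc, hd, he, z2, z4, z5, z7, z8, z9, e2_0, e2_1, e2_2, e2_3, e2_4, e2_5, e2_6, e2_7, e2_8, e2_9, e2_10]
    ring
  have e3_10 : j3 10 = (3)*b*e^2 + (6)*b*c*d + (3)*a^2*e := by
    rw [h3 10 (by norm_num)]
    simp only [sum_range_succ, range_zero, sum_empty, Nat.reduceAdd, Nat.reduceSub, Nat.reduceMod, Nat.sub_zero, zero_add,
      ha, hb, hc, hd, he, z2, z4, z5, z7, z8, z9, e2_0, e2_1, e2_2, e2_3, e2_4, e2_5, e2_6, e2_7, e2_8, e2_9, e2_10]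
    ring
  have e4_0 : j4 0 = (4)*c*e^3 + (12)*c^2*d*e + (6)*b^2*e^2 + (12)*b^2*c*d + (12)*a*d^2*e + (12)*a^2*b*e + 
      (1)*a^4 := by
    rw [h4 0 (by norm_num)]
    simp only [sum_range_succ, range_zero, sum_empty, Nat.reduceAdd, Nat.reduceSub, Nat.reduceMod, Nat.sub_zero, zero_add,
      ha, hb, hc, hd, he, z2, z4, z5, z7, z8, z9, e2_0, e2_1, e2_2, e2_3, e2_4, e2_5, e2_6, e2_7, e2_8, e2_9, e2_10]
    ring
  have e4_1 : j4 1 = (1)*c^4 + (12)*b*d^2*e + (12)*a*c*e^2 + (12)*a*c^2*d + (12)*a*b^2*e + (6)*a^2*d^2 + 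
      (4)*a^3*b := by
    rw [h4 1 (by norm_num)]
    simp only [sum_range_succ, range_zero, sum_empty, Nat.reduceAdd, Nat.reduceSub, Nat.reduceMod, Nat.sub_zero, zero_add,
      ha, hb, hc, hd, he, z2, z4, z5, z7, z8, z9, e2_0, e2_1, e2_2, e2_3, e2_4, e2_5, e2_6, e2_7, e2_8, e2_9, e2_10]
    ring
  have e4_2 : j4 2 = (1)*d^4 + (12)*b*c*e^2 + (12)*b*c^2*d + (4)*b^3*e + (12)*a*b*d^2 + (12)*a^2*c*e + 
      (6)*a^2*b^2 := by
    rw [h4 2 (by norm_num)]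
    simp only [sum_range_succ, range_zero, sum_empty, Nat.reduceAdd, Nat.reduceSub, Nat.reduceMod, Nat.sub_zero, zero_add,
      ha, hb, hc, hd, he, z2, z4, z5, z7, z8, z9, e2_0, e2_1, e2_2, e2_3, e2_4, e2_5, e2_6, e2_7, e2_8, e2_9, e2_10]
    ring
  have e4_3 : j4 3 = (4)*d*e^3 + (12)*c*d^2*e + (6)*b^2*d^2 + (24)*a*b*c*e + (4)*a*b^3 + (4)*a^3*c := by
    rw [h4 3 (by norm_num)]
    simp only [sum_range_succ, range_zero, sum_empty, Nat.reduceAdd, Nat.reduceSub, Nat.reduceMod, Nat.sub_zero, zero_add,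
      ha, hb, hc, hd, he, z2, z4, z5, z7, z8, z9, e2_0, e2_1, e2_2, e2_3, e2_4, e2_5, e2_6, e2_7, e2_8, e2_9, e2_10]
    ring
  have e4_4 : j4 4 = (6)*c^2*e^2 + (4)*c^3*d + (12)*b^2*c*e + (1)*b^4 + (12)*a*d*e^2 + (12)*a*c*d^2 + 
      (12)*a^2*b*c := by
    rw [h4 4 (by norm_num)]
    simp only [sum_range_succ, range_zero, sum_empty, Nat.reduceAdd, Nat.reduceSub, Nat.reduceMod, Nat.sub_zero, zero_add,
      ha, hb, hc, hd, he, z2, z4, z5, z7, z8, z9, e2_0, e2_1, e2_2, e2_3, e2_4, e2_5, e2_6, e2_7, e2_8, e2_9, e2_10]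
    ring
  have e4_5 : j4 5 = (12)*b*d*e^2 + (12)*b*c*d^2 + (12)*a*c^2*e + (12)*a*b^2*c + (12)*a^2*d*e := by
    rw [h4 5 (by norm_num)]
    simp only [sum_range_succ, range_zero, sum_empty, Nat.reduceAdd, Nat.reduceSub, Nat.reduceMod, Nat.sub_zero, zero_add,
      ha, hb, hc, hd, he, z2, z4, z5, z7, z8, z9, e2_0, e2_1, e2_2, e2_3, e2_4, e2_5, e2_6, e2_7, e2_8, e2_9, e2_10]
    ring
  have e4_6 : j4 6 = (4)*d^3*e + (12)*b*c^2*e + (4)*b^3*c + (24)*a*b*d*e + (6)*a^2*c^2 + (4)*a^3*d := by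
    rw [h4 6 (by norm_num)]
    simp only [sum_range_succ, range_zero, sum_empty, Nat.reduceAdd, Nat.reduceSub, Nat.reduceMod, Nat.sub_zero, zero_add,
      ha, hb, hc, hd, he, z2, z4, z5, z7, z8, z9, e2_0, e2_1, e2_2, e2_3, e2_4, e2_5, e2_6, e2_7, e2_8, e2_9, e2_10]
    ring
  have e4_7 : j4 7 = (1)*e^4 + (12)*c*d*e^2 + (6)*c^2*d^2 + (12)*b^2*d*e + (4)*a*d^3 + (12)*a*b*c^2 + 
      (12)*a^2*b*d := by
    rw [h4 7 (by norm_num)]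
    simp only [sum_range_succ, range_zero, sum_empty, Nat.reduceAdd, Nat.reduceSub, Nat.reduceMod, Nat.sub_zero, zero_add,
      ha, hb, hc, hd, he, z2, z4, z5, z7, z8, z9, e2_0, e2_1, e2_2, e2_3, e2_4, e2_5, e2_6, e2_7, e2_8, e2_9, e2_10]
    ring
  have e4_8 : j4 8 = (4)*c^3*e + (4)*b*d^3 + (6)*b^2*c^2 + (4)*a*e^3 + (24)*a*c*d*e + (12)*a*b^2*d := by
    rw [h4 8 (by norm_num)]
    simp only [sum_range_succ, range_zero, sum_empty, Nat.reduceAdd, Nat.reduceSub, Nat.reduceMod, Nat.sub_zero, zero_add,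
      ha, hb, hc, hd, he, z2, z4, z5, z7, z8, z9, e2_0, e2_1, e2_2, e2_3, e2_4, e2_5, e2_6, e2_7, e2_8, e2_9, e2_10]
    ring
  have e4_9 : j4 9 = (4)*b*e^3 + (24)*b*c*d*e + (4)*b^3*d + (4)*a*c^3 + (6)*a^2*e^2 + (12)*a^2*c*d := by
    rw [h4 9 (by norm_num)]
    simp only [sum_range_succ, range_zero, sum_empty, Nat.reduceAdd, Nat.reduceSub, Nat.reduceMod, Nat.sub_zero, zero_add,
      ha, hb, hc, hd, he, z2, z4, z5, z7, z8, z9, e2_0, e2_1, e2_2, e2_3, e2_4, e2_5, e2_6, e2_7, e2_8, e2_9, e2_10]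
    ring
  have e4_10 : j4 10 = (6)*d^2*e^2 + (4)*c*d^3 + (4)*b*c^3 + (12)*a*b*e^2 + (24)*a*b*c*d + (4)*a^3*e := by
    rw [h4 10 (by norm_num)]
    simp only [sum_range_succ, range_zero, sum_empty, Nat.reduceAdd, Nat.reduceSub, Nat.reduceMod, Nat.sub_zero, zero_add,
      ha, hb, hc, hd, he, z2, z4, z5, z7, z8, z9, e2_0, e2_1, e2_2, e2_3, e2_4, e2_5, e2_6, e2_7, e2_8, e2_9, e2_10]
    ring
  simp only [sum_range_succ, range_zero, sum_empty, Nat.reduceAdd, Nat.reduceSub, Nat.reduceMod, Nat.sub_zero, zero_add, y3, y6, y8, y9, y10, mul_zero, add_zero]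
  rw [e4_3] at y3
  rw [e4_6] at y6
  rw [e4_8] at y8
  rw [e4_9] at y9
  rw [e4_10] at y10
  simp only [e3_0, e3_1, e3_2, e3_3, e3_4, e3_5, e3_6, e3_7, e3_8, e3_9, e3_10, e4_0, e4_1, e4_2, e4_3, e4_4, e4_5, e4_6, e4_7, e4_8, e4_9, e4_10]
  linear_combination ((-7)*b*c*e + (-2)*b^3 + (1)*a^2*c) * y3 + ((1)*d^2*e + (-7)*a*b*e + (-2)*a^3) * y6 + 
      ((-2)*c^3 + (1)*a*e^2 + (-7)*a*c*d) * y8 + ((-2)*e^3 + (-7)*c*d*e + (1)*b^2*d) * y9 + 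
      ((-2)*d^3 + (1)*b*c^2 + (-7)*a*b*d) * y10 + ((1)*d^5*e^2 + (1)*c*d^6 + (1)*c^6*e + 
      (1)*b*e^6 + (22)*b*c*d*e^4 + (54)*b*c^2*d^2*e^2 + (12)*b*c^3*d^3 + (1)*b^2*c^5 + 
      (12)*b^3*d*e^3 + (30)*b^3*c*d^2*e + (1)*b^5*d^2 + (12)*a*c^3*e^3 + (22)*a*c^4*d*e + 
      (30)*a*b*d^3*e^2 + (22)*a*b*c*d^4 + (54)*a*b^2*c^2*e^2 + (30)*a*b^2*c^3*d + 
      (22)*a*b^4*c*e + (1)*a*b^6 + (1)*a^2*e^5 + (30)*a^2*c*d*e^3 + (54)*a^2*c^2*d^2*e + 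
      (54)*a^2*b^2*d*e^2 + (54)*a^2*b^2*c*d^2 + (12)*a^3*d^3*e + (30)*a^3*b*c^2*e + 
      (12)*a^3*b^3*c + (22)*a^4*b*d*e + (1)*a^5*c^2 + (1)*a^6*d) * h11

/-- Part of a power series supported on the residue class `r` modulo 11. -/
def res (r : ℕ) (G : F⟦X⟧) : F⟦X⟧ := PowerSeries.mk fun n => if n % 11 = r then coeff n G else 0

lemma res_mul (r : ℕ) (hr : r < 11) (P Q : F⟦X⟧) :
    res r (P * Q) = ∑ s ∈ range 11, res s P * res ((r + 11 - s) % 11) Q := by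
  ext n
  simp only [res, coeff_mk, map_sum, coeff_mul]
  rw [sum_comm]
  split_ifs with h
  · refine sum_congr rfl fun x hx => ?_
    rw [HasAntidiagonal.mem_antidiagonal] at hx
    rw [sum_eq_single_of_mem (x.1 % 11) (by simp; omega)]
    · rw [if_pos rfl, if_pos (by omega)]
    · intro s _ hs
      rw [if_neg (Ne.symm hs), zero_mul]
  · symm
    refine sum_eq_zero fun x hx => sum_eq_zero fun s hs => ?_
    rw [HasAntidiagonal.mem_antidiagonal] at hx
    rw [mem_range] at hs
    by_cases h1 : x.1 % 11 = s
    · rw [if_neg (c := x.2 % 11 = _) (by omega), mul_zero]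
    · rw [if_neg h1, zero_mul]

lemma res_zero_of (r : ℕ) (G : F⟦X⟧) (h : ∀ n, n % 11 = r → coeff n G = 0) : res r G = 0 := by
  ext n
  simp only [res, coeff_mk, map_zero]
  split_ifs with hn
  · exact h n hn
  · rfl

lemma coeff_of_res (r : ℕ) (G : F⟦X⟧) (h : res r G = 0) (n : ℕ) (hn : n % 11 = r) :
    coeff n G = 0 := by
  have := congrArg (coeff n) h
  simpa [res, hn] using this

/-- `eul(q^11)`. -/
def e11 : F⟦X⟧ := expand 11 (by norm_num) eul

lemma eul_pow : eul ^ 11 = e11 := by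
  have h := MvPowerSeries.map_frobenius_expand (σ := Unit) (R := F) (p := 11) (by norm_num) (f := eul)
  rw [ZMod.frobenius_zmod] at h
  rw [e11, PowerSeries.expand]
  rw [← h]
  simp

lemma e11_ne : e11 ≠ 0 := by
  rw [← eul_pow]
  exact pow_ne_zero _ eul_unit.ne_zero

lemma res_mul_e11 (r : ℕ) (P : F⟦X⟧) : res r (P * e11) = res r P * e11 := by
  ext n
  simp only [res, coeff_mk, coeff_mul, e11]
  split_ifs with h
  · refine sum_congr rfl fun x hx => ?_
    rw [HasAntidiagonal.mem_antidiagonal] at hx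
    by_cases h2 : 11 ∣ x.2
    · rw [if_pos (by omega)]
    · rw [coeff_expand_of_not_dvd _ _ _ h2]; simp
  · symm
    refine sum_eq_zero fun x hx => ?_
    rw [HasAntidiagonal.mem_antidiagonal] at hx
    by_cases h2 : 11 ∣ x.2
    · rw [if_neg (by omega)]; simp
    · rw [coeff_expand_of_not_dvd _ _ _ h2]; simp

lemma res_eul (r : ℕ) (hr : r ∈ ({3,6,8,9,10} : Finset ℕ)) : res r eul = 0 := by
  refine res_zero_of _ _ fun n hn => ?_
  refine coeff_pentagonalSeries_eq_zero _ ?_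
  rintro ⟨k, rfl⟩
  have h := two_mul_natCast_pentagonal k
  have h2 : (2 * (pentagonal k : ℤ)) % 11 = (k % 11) * (3 * (k % 11) - 1) % 11 := by
    rw [h]
    exact Int.ModEq.mul (Int.mod_modEq _ _).symm
      (Int.ModEq.sub (Int.ModEq.mul rfl (Int.mod_modEq _ _).symm) rfl)
  have h3 : 0 ≤ k % 11 := by omega
  have h4 : k % 11 < 11 := by omega
  generalize k % 11 = t at *
  simp only [mem_insert, mem_singleton] at hr
  interval_cases t <;> omega

lemma eleven_zero : (11 : F⟦X⟧) = 0 := by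
  have h : (11 : F) = 0 := by decide
  have h2 := congrArg (C (R := F)) h
  rw [map_zero] at h2
  rw [← h2, map_ofNat]

lemma res_eul_ten : res 6 (eul ^ 10) = 0 := by
  obtain ⟨J, hJ⟩ : ∃ J, J = eul ^ 3 := ⟨_, rfl⟩
  have hz : ∀ r ∈ ({2,4,5,7,8,9} : Finset ℕ), res r J = 0 := fun r hr => by
    rw [hJ]
    exact res_zero_of _ _ fun n hn => jacobi n (by rw [hn]; exact hr)
  have hy : ∀ r ∈ ({3,6,8,9,10} : Finset ℕ), res r (J ^ 2 * J ^ 2) = 0 := fun r hr => by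
    have : J ^ 2 * J ^ 2 = eul * e11 := by rw [← eul_pow, hJ]; ring
    rw [this, res_mul_e11, res_eul r hr, zero_mul]
  have h2 : ∀ r < 11, res r (J ^ 2) = ∑ s ∈ range 11, res s J * res ((r + 11 - s) % 11) J := by
    intro r hr
    rw [sq]
    exact res_mul r hr _ _
  have key := alg (A := F⟦X⟧) eleven_zero
    (fun r => res r J) (fun r => res r (J ^ 2)) (fun r => res r (J ^ 2 * J))
    (fun r => res r (J ^ 2 * J ^ 2))
    (hz 2 (by simp)) (hz 4 (by simp)) (hz 5 (by simp)) (hz 7 (by simp))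
    (hz 8 (by simp)) (hz 9 (by simp))
    h2 (fun r hr => res_mul r hr _ _)
    (fun r hr => res_mul r hr _ _)
    (hy 3 (by simp)) (hy 6 (by simp)) (hy 8 (by simp)) (hy 9 (by simp)) (hy 10 (by simp))
  have h7 : res 6 (eul ^ 10 * e11) = 0 := by
    have : eul ^ 10 * e11 = (J ^ 2 * J) * (J ^ 2 * J ^ 2) := by rw [← eul_pow, hJ]; ring
    rw [this, res_mul 6 (by norm_num)]
    exact key
  rw [res_mul_e11] at h7
  exact (mul_eq_zero.mp h7).resolve_right e11_ne

/-- Multisets of positive integers of sum `m`, all odd if `i ≠ 0`. -/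
def parts (i : Fin 11) (m : ℕ) : Finset (Multiset ℕ) :=
  (Nat.Partition.restricted m (fun x => i.val ≠ 0 → Odd x)).map
    ⟨Nat.Partition.parts, fun _ _ h => Nat.Partition.ext h⟩

lemma mem_parts (i : Fin 11) (m : ℕ) (s : Multiset ℕ) :
    s ∈ parts i m ↔ (∀ x ∈ s, 0 < x) ∧ (i.val ≠ 0 → ∀ x ∈ s, Odd x) ∧ s.sum = m := by
  simp only [parts, Nat.Partition.restricted, Finset.mem_map, Finset.mem_filter,
    Finset.mem_univ, true_and, Function.Embedding.coeFn_mk]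
  constructor
  · rintro ⟨p, hp, rfl⟩
    exact ⟨fun x hx => p.parts_pos hx, fun hi x hx => hp x hx hi, p.parts_sum⟩
  · rintro ⟨h1, h2, h3⟩
    exact ⟨⟨s, fun {x} hx => h1 x hx, h3⟩, fun x hx hi => h2 hi x hx, rfl⟩

/-- Generating function of one component. -/
def comp (i : Fin 11) : F⟦X⟧ := PowerSeries.mk fun m => ((parts i m).card : F)

lemma gf : (PowerSeries.mk fun n => (coloredPartition 11 n : F)) = ∏ i, comp i := by
  classical
  ext n
  rw [coeff_mk, PowerSeries.coeff_prod]
  have hset : {c : Fin 11 → Multiset ℕ |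
    (∀ i, ∀ x ∈ c i, 0 < x) ∧
    (∀ i : Fin 11, i.val ≠ 0 → ∀ x ∈ c i, Odd x) ∧
    (∑ i, (c i).sum) = n} = (((finsuppAntidiag (univ : Finset (Fin 11)) n).biUnion
      fun l => Fintype.piFinset fun i => parts i (l i) : Finset (Fin 11 → Multiset ℕ)) :
        Set (Fin 11 → Multiset ℕ)) := by
    ext c
    simp only [Set.mem_ofPred_eq, Finset.coe_biUnion, Set.mem_iUnion, Finset.mem_coe,
      Fintype.mem_piFinset, mem_parts, mem_finsuppAntidiag]
    constructor
    · rintro ⟨h1, h2, h3⟩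
      exact ⟨Finsupp.equivFunOnFinite.symm fun i => (c i).sum, ⟨by simpa using h3, by simp⟩,
        fun i => ⟨h1 i, h2 i, by simp⟩⟩
    · rintro ⟨l, ⟨hl, -⟩, h⟩
      refine ⟨fun i => (h i).1, fun i => (h i).2.1, ?_⟩
      rw [← hl]
      exact sum_congr rfl fun i _ => (h i).2.2
  rw [coloredPartition, hset, Set.ncard_coe_finset, card_biUnion]
  · push_cast
    refine sum_congr rfl fun l _ => ?_
    rw [Fintype.card_piFinset]
    push_cast
    refine prod_congr rfl fun i _ => ?_
    rw [comp, coeff_mk]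
  · intro l _ l' _ hne
    rw [Function.onFun, Finset.disjoint_left]
    intro c hc hc'
    rw [Fintype.mem_piFinset] at hc hc'
    apply hne
    ext i
    have h1 := (mem_parts _ _ _).mp (hc i)
    have h2 := (mem_parts _ _ _).mp (hc' i)
    rw [← h1.2.2, ← h2.2.2]

section topo
open scoped PowerSeries.WithPiTopology

lemma hasProd_expand (f : ℕ → F⟦X⟧) (g : F⟦X⟧) (h : HasProd f g) :
    HasProd (fun i => expand 2 (by norm_num) (f i)) (expand 2 (by norm_num) g) := by
  rw [HasProd, WithPiTopology.tendsto_iff_coeff_tendsto] at h ⊢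
  intro n
  simp only [← map_prod, coeff_expand]
  split_ifs
  · exact h _
  · exact tendsto_const_nhds

lemma comp_zero : comp 0 * eul = 1 := by
  have h1 := Nat.Partition.hasProd_powerSeriesMk_card_restricted F
    (fun x => (0 : Fin 11).val ≠ 0 → Odd x)
  have h2 := WithPiTopology.hasProd_one_sub_X_pow F
  have h3 := h1.mul h2
  have h4 : comp 0 = PowerSeries.mk fun n => 
     ((Nat.Partition.restricted n (fun x => (0 : Fin 11).val ≠ 0 → Odd x)).card : F) := by
    ext n
    simp [comp, parts]
  rw [h4]
  refine HasProd.unique h3 ?_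
  convert hasProd_one using 2 with i
  rw [if_pos (by simp)]
  simp only [pow_mul]
  exact WithPiTopology.tsum_pow_mul_one_sub_of_constantCoeff_eq_zero (by simp)

lemma comp_ne (i : Fin 11) (hi : i ≠ 0) : comp i * eul = expand 2 (by norm_num) eul := by
  have h1 := Nat.Partition.hasProd_powerSeriesMk_card_countRestricted F (m := 2) (by norm_num)
  have h2 := WithPiTopology.hasProd_one_sub_X_pow F
  have h3 := h1.mul h2
  have h4 : comp i = PowerSeries.mk fun n => 
     ((Nat.Partition.countRestricted n 2).card : F) := by
    ext n
    rw [coeff_mk, Nat.Partition.countRestricted_two, ← Nat.Partition.card_odds_eq_card_distincts]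
    have hi' : i.val ≠ 0 := fun h => hi (Fin.ext h)
    simp [comp, parts, Nat.Partition.odds, Nat.Partition.restricted, hi]
  rw [h4]
  refine HasProd.unique h3 ?_
  have h5 := hasProd_expand _ _ h2
  have h6 : (fun b => (∑ j ∈ range 2, X ^ ((b + 1) * j)) * (1 - X ^ (b + 1))) =
      fun i : ℕ => expand 2 (by norm_num) (1 - X ^ (i + 1) : F⟦X⟧) := by
    funext b
    simp only [sum_range_succ, map_sub, map_one, map_pow, expand_X]
    simp
    ring
  rw [h6]
  exact h5

end topo

lemma gf_mul : (PowerSeries.mk fun n => (coloredPartition 11 n : F)) * e11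
    = expand 2 (by norm_num) (eul ^ 10) := by
  have h : ∏ i : Fin 11, (comp i * eul) = expand 2 (by norm_num) (eul ^ 10) := by
    rw [Fin.prod_univ_succ, comp_zero, one_mul,
      prod_congr rfl fun i _ => comp_ne (Fin.succ i) (Fin.succ_ne_zero i)]
    simp
  rw [gf, ← eul_pow, ← h, prod_mul_distrib]
  simp

lemma main (n : ℕ) : 11 ∣ coloredPartition 11 (11 * n + 1) := by
  have h1 : res 1 (expand 2 (by norm_num) (eul ^ 10)) = 0 := by
    refine res_zero_of _ _ fun n hn => ?_
    rw [coeff_expand]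
    split_ifs with h
    · exact coeff_of_res 6 _ res_eul_ten _ (by omega)
    · rfl
  rw [← gf_mul, res_mul_e11] at h1
  have h2 := coeff_of_res 1 _ ((mul_eq_zero.mp h1).resolve_right e11_ne) (11 * n + 1) (by omega)
  rw [coeff_mk] at h2
  exact (ZMod.natCast_eq_zero_iff _ _).mp h2

end

end CP11

/-- Ramanujan-type congruence: `a_{11}(11n + 1) ≡ 0 (mod 11)` for all `n ≥ 0`. -/
theorem coloredPartition_eleven_mod_eleven (n : ℕ) :
    11 ∣ coloredPartition 11 (11 * n + 1) := by
  exact CP11.main n
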